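/- For 0<q<p≤1, n∈ℕ with n≥1, and x≥0, the (p,q)-Baskakov operator reproduces constants: B_{n,p,q}(1;x) = Σ_{k=0}^∞ [n+k−1 choose k]_{p,q} p^{k+n(n−1)/2} q^{k(k−1)/2} x^k/(1⊕x)^{n+k}_{p,q} = 1. -/

import Mathlib

open Real Set Filter

/-- The (p,q)-integer [n]_{p,q} = (p^n - q^n)/(p - q). -/
noncomputable def pqInt (p q : ℝ) (n : ℕ) : ℝ := (p ^ n - q ^ n) / (p - q)

/-- The (p,q)-factorial [n]_{p,q}! . -/
noncomputable def pqFact (p q : ℝ) : ℕ → ℝ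
  | 0 => 1
  | n + 1 => pqInt p q (n + 1) * pqFact p q n

/-- The (p,q)-binomial coefficient. -/
noncomputable def pqChoose (p q : ℝ) (n k : ℕ) : ℝ :=
  pqFact p q n / (pqFact p q k * pqFact p q (n - k))

/-- (1 ⊕ x)^n_{p,q} = ∏_{j=0}^{n-1} (p^j + q^j x). -/
noncomputable def pqOnePlusPow (p q x : ℝ) (n : ℕ) : ℝ :=
  ∏ j ∈ Finset.range n, (p ^ j + q ^ j * x)

/-- The (p,q)-Baskakov operator B_{n,p,q}(f;x). -/
noncomputable def baskakov (p q : ℝ) (n : ℕ) (f : ℝ → ℝ) (x : ℝ) : ℝ :=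
  ∑' k : ℕ, pqChoose p q (n + k - 1) k * p ^ (k + n * (n - 1) / 2) *
    q ^ (k * (k - 1) / 2) * (x ^ k / pqOnePlusPow p q x (n + k)) *
    f (p ^ (n - 1) * pqInt p q k / (q ^ (k - 1) * pqInt p q n))

/-- The function r_n(x) used in the King-type modification. -/
noncomputable def rn (p q : ℝ) (n : ℕ) (x : ℝ) : ℝ :=
  (-(p ^ (n - 1)) +
      Real.sqrt (p ^ (2 * n - 2) + 4 * pqInt p q n * (pqInt p q n + p ^ n / q) * x ^ 2)) /
    (2 * (pqInt p q n + p ^ n / q))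

/-- The King-type (p,q)-Baskakov operator B*_{n,p,q}(f;x) = B_{n,p,q}(f; r_n(x)). -/
noncomputable def kingBaskakov (p q : ℝ) (n : ℕ) (f : ℝ → ℝ) (x : ℝ) : ℝ :=
  baskakov p q n f (rn p q n x)

lemma pqInt_pos {p q : ℝ} (hq : 0 < q) (hqp : q < p) {n : ℕ} (hn : n ≠ 0) : 0 < pqInt p q n :=
  div_pos (sub_pos.2 (pow_lt_pow_left₀ hqp hq.le hn)) (sub_pos.2 hqp)

lemma pqFact_pos {p q : ℝ} (hq : 0 < q) (hqp : q < p) (n : ℕ) : 0 < pqFact p q n := by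
  induction n with
  | zero => exact one_pos
  | succ n ih => exact mul_pos (pqInt_pos hq hqp n.succ_ne_zero) ih

lemma pqInt_add {p q : ℝ} (m n : ℕ) :
    pqInt p q (m + n) = p ^ n * pqInt p q m + q ^ m * pqInt p q n := by
  simp only [pqInt, pow_add]
  ring

lemma pqOnePlusPow_pos {p q x : ℝ} (hp : 0 < p) (hq : 0 < q) (hx : 0 ≤ x) (n : ℕ) :
    0 < pqOnePlusPow p q x n :=
  Finset.prod_pos fun _ _ => by positivity

lemma pqOnePlusPow_succ (p q x : ℝ) (n : ℕ) :
    pqOnePlusPow p q x (n + 1) = pqOnePlusPow p q x n * (p ^ n + q ^ n * x) :=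
  Finset.prod_range_succ _ _

/-- The term of index `k` in the expansion of `(1 ⊕ x)^{n+k}` by the (p,q)-binomial theorem,
divided by `(1 ⊕ x)^{n+k}`. -/
noncomputable def pqBinomialTerm (p q x : ℝ) (n k : ℕ) : ℝ :=
  pqFact p q (n + k) / (pqFact p q k * pqFact p q n) * p ^ (n * (n - 1) / 2) *
    q ^ (k * (k - 1) / 2) * x ^ k / pqOnePlusPow p q x (n + k)

/-- The weight of index `k` in the (p,q)-Baskakov operator of order `n`. -/
noncomputable def baskakovWeight (p q x : ℝ) (n k : ℕ) : ℝ :=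
  pqChoose p q (n + k - 1) k * p ^ (k + n * (n - 1) / 2) *
    q ^ (k * (k - 1) / 2) * (x ^ k / pqOnePlusPow p q x (n + k))

section

variable {p q x : ℝ}

lemma pqBinomialTerm_nonneg (hq : 0 < q) (hqp : q < p) (hx : 0 ≤ x) (n k : ℕ) :
    0 ≤ pqBinomialTerm p q x n k := by
  have hp := hq.trans hqp
  have h1 := pqFact_pos hq hqp (n + k)
  have h2 := pqFact_pos hq hqp k
  have h3 := pqFact_pos hq hqp n
  have h4 := pqOnePlusPow_pos hp hq hx (n + k)
  unfold pqBinomialTerm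
  positivity

lemma pqBinomialTerm_succ_right (hq : 0 < q) (hqp : q < p) (hx : 0 ≤ x) (n k : ℕ) :
    pqBinomialTerm p q x n (k + 1) =
      pqInt p q (n + k + 1) / pqInt p q (k + 1) * (q ^ k * x / (p ^ (n + k) + q ^ (n + k) * x)) *
        pqBinomialTerm p q x n k := by
  have hp := hq.trans hqp
  have h2 := (pqFact_pos hq hqp k).ne'
  have h3 := (pqFact_pos hq hqp n).ne'
  have h4 := (pqOnePlusPow_pos hp hq hx (n + k)).ne'
  have h5 := (pqInt_pos hq hqp k.succ_ne_zero).ne'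
  have h6 : p ^ (n + k) + q ^ (n + k) * x ≠ 0 := by positivity
  rw [pqBinomialTerm, pqBinomialTerm, ← add_assoc]
  simp only [pqFact, pqOnePlusPow_succ, Nat.triangle_succ, pow_add, pow_one] at h6 ⊢
  field_simp

lemma pqBinomialTerm_succ_left (hq : 0 < q) (hqp : q < p) (hx : 0 ≤ x) (n k : ℕ) :
    pqBinomialTerm p q x (n + 1) k =
      pqInt p q (n + k + 1) / pqInt p q (n + 1) * (p ^ n / (p ^ (n + k) + q ^ (n + k) * x)) *
        pqBinomialTerm p q x n k := by
  have hp := hq.trans hqp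
  have h2 := (pqFact_pos hq hqp k).ne'
  have h3 := (pqFact_pos hq hqp n).ne'
  have h4 := (pqOnePlusPow_pos hp hq hx (n + k)).ne'
  have h5 := (pqInt_pos hq hqp n.succ_ne_zero).ne'
  have h6 : p ^ (n + k) + q ^ (n + k) * x ≠ 0 := by positivity
  simp only [pqBinomialTerm, add_right_comm n 1 k, pqFact, pqOnePlusPow_succ, Nat.triangle_succ,
    pow_add] at h6 ⊢
  field_simp

lemma baskakovWeight_succ (n k : ℕ) :
    baskakovWeight p q x (n + 1) k =
      p ^ (n + k) / (p ^ (n + k) + q ^ (n + k) * x) * pqBinomialTerm p q x n k := by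
  have h : n + 1 + k - 1 = n + k := by omega
  rw [baskakovWeight, h, pqBinomialTerm, pqChoose, add_right_comm n 1 k, pqOnePlusPow_succ,
    Nat.triangle_succ, Nat.add_sub_cancel]
  simp only [pow_add, div_eq_mul_inv, mul_inv]
  ring

lemma baskakovWeight_nonneg (hq : 0 < q) (hqp : q < p) (hx : 0 ≤ x) (n k : ℕ) :
    0 ≤ baskakovWeight p q x (n + 1) k := by
  have hp := hq.trans hqp
  have := pqBinomialTerm_nonneg hq hqp hx n k
  rw [baskakovWeight_succ]
  positivity

lemma baskakovWeight_one (hq : 0 < q) (hqp : q < p) (hx : 0 ≤ x) (k : ℕ) :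
    baskakovWeight p q x 1 k = pqBinomialTerm p q x 0 k - pqBinomialTerm p q x 0 (k + 1) := by
  have hp := hq.trans hqp
  have h6 : p ^ k + q ^ k * x ≠ 0 := by positivity
  have h5 := (pqInt_pos hq hqp k.succ_ne_zero).ne'
  rw [← zero_add 1, baskakovWeight_succ, pqBinomialTerm_succ_right hq hqp hx]
  simp only [zero_add]
  field_simp
  ring

lemma baskakovWeight_succ_succ (hq : 0 < q) (hqp : q < p) (hx : 0 ≤ x) (n k : ℕ) :
    baskakovWeight p q x (n + 1) (k + 1) =
      pqBinomialTerm p q x (n + 1) (k + 1) - pqBinomialTerm p q x (n + 1) k +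
        baskakovWeight p q x (n + 2) k := by
  have hp := hq.trans hqp
  have h5 := (pqInt_pos hq hqp k.succ_ne_zero).ne'
  have h7 := (pqInt_pos hq hqp n.succ_ne_zero).ne'
  have h6 : p ^ (n + k) + q ^ (n + k) * x ≠ 0 := by positivity
  have h8 : p ^ (n + k + 1) + q ^ (n + k + 1) * x ≠ 0 := by positivity
  have h9 : pqInt p q (n + k + 1 + 1) =
      p ^ (k + 1) * pqInt p q (n + 1) + q ^ (n + 1) * pqInt p q (k + 1) := by
    rw [← pqInt_add]
    congr 1
    omega
  rw [baskakovWeight_succ, baskakovWeight_succ, pqBinomialTerm_succ_right hq hqp hx (n + 1),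
    pqBinomialTerm_succ_left hq hqp hx, pqBinomialTerm_succ_right hq hqp hx n]
  simp only [← add_assoc, add_right_comm n 1 k]
  rw [h9]
  generalize pqInt p q (n + 1) = a at *
  generalize pqInt p q (k + 1) = b at *
  generalize pqInt p q (n + k + 1) = c at *
  field_simp
  ring

lemma sum_baskakovWeight_one (hq : 0 < q) (hqp : q < p) (hx : 0 ≤ x) (K : ℕ) :
    ∑ k ∈ Finset.range K, baskakovWeight p q x 1 k = 1 - pqBinomialTerm p q x 0 K := by
  simp_rw [baskakovWeight_one hq hqp hx]
  rw [Finset.sum_range_sub']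
  simp [pqBinomialTerm, pqFact, pqOnePlusPow]

lemma sum_baskakovWeight_succ (hq : 0 < q) (hqp : q < p) (hx : 0 ≤ x) (n K : ℕ) :
    ∑ k ∈ Finset.range (K + 1), baskakovWeight p q x (n + 1) k =
      pqBinomialTerm p q x (n + 1) K + ∑ k ∈ Finset.range K, baskakovWeight p q x (n + 2) k := by
  induction K with
  | zero =>
    have h := (pqInt_pos hq hqp n.succ_ne_zero).ne'
    simp [baskakovWeight_succ, pqBinomialTerm_succ_left hq hqp hx, div_self h]
  | succ K ih =>
    rw [Finset.sum_range_succ, ih, baskakovWeight_succ_succ hq hqp hx, Finset.sum_range_succ]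
    ring

lemma pqInt_div_pqInt_le (hq : 0 < q) (hqp : q < p) (hp : p ≤ 1) (n k : ℕ) :
    pqInt p q (n + k + 1) / pqInt p q (k + 1) ≤ p / (p - q) := by
  have hp0 := hq.trans hqp
  have hpq := sub_pos.2 hqp
  rw [div_le_div_iff₀ (pqInt_pos hq hqp k.succ_ne_zero) hpq]
  have h1 : p ^ (n + k + 1) ≤ p ^ (k + 1) := pow_le_pow_of_le_one hp0.le hp (by omega)
  have h2 : q ^ k ≤ p ^ k := pow_le_pow_left₀ hq.le hqp.le k
  have h3 : 0 < q ^ (n + k + 1) := by positivity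
  have h4 : p ^ (k + 1) * (p - q) ≤ p * (p ^ (k + 1) - q ^ (k + 1)) := by
    have := mul_le_mul_of_nonneg_left h2 (mul_pos hp0 hq).le
    rw [pow_succ, pow_succ]
    linarith
  rw [pqInt, pqInt, div_mul_cancel₀ _ hpq.ne', ← mul_div_assoc, le_div_iff₀ hpq]
  refine le_trans ?_ h4
  exact mul_le_mul_of_nonneg_right (by linarith) hpq.le

lemma tendsto_pqBinomialTerm (hq : 0 < q) (hqp : q < p) (hp : p ≤ 1) (hx : 0 ≤ x) (n : ℕ) :
    Tendsto (pqBinomialTerm p q x n) atTop (nhds 0) := by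
  have hp0 := hq.trans hqp
  have hlim : Tendsto (fun k : ℕ => p / (p - q) * ((q / p) ^ k * (x / p ^ n))) atTop (nhds 0) := by
    simpa using ((tendsto_pow_atTop_nhds_zero_of_lt_one (by positivity)
      ((div_lt_one hp0).2 hqp)).mul_const (x / p ^ n)).const_mul (p / (p - q))
  refine (summable_of_ratio_norm_eventually_le (r := 1 / 2) (by norm_num) ?_).tendsto_atTop_zero
  filter_upwards [hlim.eventually_le_const (by norm_num : (0 : ℝ) < 1 / 2)] with k hk
  have hnn := pqBinomialTerm_nonneg hq hqp hx n
  rw [Real.norm_of_nonneg (hnn _), Real.norm_of_nonneg (hnn _),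
    pqBinomialTerm_succ_right hq hqp hx]
  refine mul_le_mul_of_nonneg_right (le_trans ?_ hk) (hnn k)
  have hle : q ^ k * x / (p ^ (n + k) + q ^ (n + k) * x) ≤ (q / p) ^ k * (x / p ^ n) := by
    calc q ^ k * x / (p ^ (n + k) + q ^ (n + k) * x) ≤ q ^ k * x / p ^ (n + k) := by
          gcongr
          exact le_add_of_nonneg_right (by positivity)
      _ = (q / p) ^ k * (x / p ^ n) := by
          rw [div_pow, pow_add]
          field_simp
  exact mul_le_mul (pqInt_div_pqInt_le hq hqp hp n k) hle (by positivity)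
    (div_nonneg hp0.le (sub_pos.2 hqp).le)

theorem hasSum_baskakovWeight (hq : 0 < q) (hqp : q < p) (hp : p ≤ 1) (hx : 0 ≤ x) (n : ℕ) :
    HasSum (baskakovWeight p q x (n + 1)) 1 := by
  rw [hasSum_iff_tendsto_nat_of_nonneg (baskakovWeight_nonneg hq hqp hx n)]
  induction n with
  | zero =>
    simpa [sum_baskakovWeight_one hq hqp hx] using
      (tendsto_pqBinomialTerm hq hqp hp hx 0).const_sub 1
  | succ n ih =>
    have h := ((tendsto_add_atTop_iff_nat 1).2 ih).sub
      (tendsto_pqBinomialTerm hq hqp hp hx (n + 1))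
    simpa [sum_baskakovWeight_succ hq hqp hx] using h

end

theorem baskakov_const_one (p q : ℝ) (n : ℕ) (x : ℝ)
    (hq : 0 < q) (hqp : q < p) (hp : p ≤ 1) (hn : 1 ≤ n) (hx : 0 ≤ x) :
    baskakov p q n (fun _ => 1) x = 1 := by
  obtain ⟨m, rfl⟩ := Nat.exists_eq_add_of_le' hn
  simpa only [baskakov, baskakovWeight, mul_one] using
    (hasSum_baskakovWeight hq hqp hp hx m).tsum_eq
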